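/- arXiv:1905.04660 — 2 statements merged into one kernel-verified Lean document; each statement's English description precedes it below -/
import Mathlib

section
/- Let w₁,…,w_N be {0,1}-valued random variables, Z₁,…,Z_N real numbers, and μ̂ = (1/N)∑ᵢ wᵢZᵢ. Let zⱼ = wⱼZⱼ and define a probability distribution S on [N] by S(j) = Var(zⱼ)/∑ᵢVar(zᵢ) (assuming the denominator is positive). If one samples j ∼ S and then conditions on the value of wⱼ, the expected decrease in variance satisfies Var(μ̂) − E_{j∼S} E_{bⱼ}[Var(μ̂ | wⱼ = bⱼ)] ≥ Var(μ̂)² / ((1/N)∑ᵢ Var(zᵢ)). -/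
open MeasureTheory ProbabilityTheory

lemma aux_cs {Ω : Type*} [MeasurableSpace Ω] (μ : Measure Ω) [IsProbabilityMeasure μ]
    {X Y : Ω → ℝ} (hX : MemLp X 2 μ) (hY : MemLp Y 2 μ) :
    (covariance X Y μ) ^ 2 ≤ variance X μ * variance Y μ := by
  have key : ∀ t : ℝ, 0 ≤ variance Y μ * (t * t) + (-2 * covariance X Y μ) * t
      + variance X μ := by
    intro t
    have h0 : 0 ≤ variance (X - t • Y) μ := variance_nonneg _ _
    have hY' : MemLp (t • Y) 2 μ := hY.const_smul t
    rw [← covariance_self (hX.sub hY').aestronglyMeasurable.aemeasurable,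
      covariance_sub_sub hX hY' hX hY', covariance_smul_left, covariance_smul_right,
      covariance_smul_left, covariance_smul_right, covariance_comm Y X,
      covariance_self hX.aestronglyMeasurable.aemeasurable,
      covariance_self hY.aestronglyMeasurable.aemeasurable] at h0
    linarith
  have := discrim_le_zero key
  unfold discrim at this
  linarith

lemma aux_step {Ω : Type*} {m : MeasurableSpace Ω} [m0 : MeasurableSpace Ω]
    (μ : Measure Ω) [IsProbabilityMeasure μ] (hm : m ≤ m0)
    {X Y : Ω → ℝ} (hX : MemLp X 2 μ) (hY : MemLp Y 2 μ) (hYm : StronglyMeasurable[m] Y) :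
    (covariance X Y μ) ^ 2 ≤ variance Y μ * (variance X μ -
      ∫ ω, ((μ[fun x => (X x) ^ 2 | m]) ω - ((μ[X | m]) ω) ^ 2) ∂μ) := by
  have h1 : ∫ ω, ((μ[fun x => (X x) ^ 2 | m]) ω - ((μ[X | m]) ω) ^ 2) ∂μ
      = ∫ ω, (condVar m X μ) ω ∂μ :=
    integral_congr_ae (condVar_ae_eq_condExp_sq_sub_sq_condExp hm hX).symm
  have h2 := integral_condVar_add_variance_condExp hm hX
  have hc : MemLp (μ[X | m]) 2 μ := MemLp.condExp (by norm_num) hX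
  have h3 : covariance X Y μ = covariance (μ[X | m]) Y μ := by
    rw [covariance_eq_sub hX hY, covariance_eq_sub hc hY, integral_condExp hm]
    congr 1
    rw [← integral_condExp hm (f := X * Y)]
    exact integral_congr_ae (condExp_mul_of_stronglyMeasurable_right hYm
      (hX.integrable_mul hY) (hX.integrable (by norm_num)))
  have h4 := aux_cs μ hc hY
  rw [h3, h1, ← h2]
  linarith

/-- One-dimensional concentration rounding: sampling a coordinate `j` with probability
proportional to `Var(wⱼZⱼ)` and conditioning on the value of `wⱼ` decreases the variance
of `μ̂ = (1/N)∑ᵢ wᵢZᵢ` by at least `Var(μ̂)² / ((1/N)∑ᵢ Var(wᵢZᵢ))` in expectation.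
Here `E_{bⱼ}[Var(μ̂ | wⱼ = bⱼ)] = E[Var(μ̂ | wⱼ)] = E[E[μ̂²|wⱼ] − (E[μ̂|wⱼ])²]`. -/
theorem stmt2 {Ω : Type*} [MeasurableSpace Ω] (μ : Measure Ω) [IsProbabilityMeasure μ]
    (N : ℕ) (hN : 0 < N) (w : Fin N → Ω → ℝ) (Z : Fin N → ℝ)
    (hw : ∀ i, Measurable (w i)) (hw01 : ∀ i ω, w i ω = 0 ∨ w i ω = 1)
    (z : Fin N → Ω → ℝ) (hz : ∀ i, z i = fun ω => w i ω * Z i)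
    (μhat : Ω → ℝ) (hμhat : μhat = fun ω => (N : ℝ)⁻¹ * ∑ i, w i ω * Z i)
    (hden : 0 < ∑ i, variance (z i) μ) :
    (variance μhat μ) ^ 2 / ((N : ℝ)⁻¹ * ∑ i, variance (z i) μ) ≤
      variance μhat μ -
        ∑ j, (variance (z j) μ / ∑ i, variance (z i) μ) *
          ∫ ω, ((μ[fun x => (μhat x) ^ 2 | MeasurableSpace.comap (w j) inferInstance]) ω -
            ((μ[μhat | MeasurableSpace.comap (w j) inferInstance]) ω) ^ 2) ∂μ := by
  have hzL : ∀ i, MemLp (z i) 2 μ := by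
    intro i
    refine MemLp.of_bound (C := |Z i|) ?_ ?_
    · rw [hz i]
      exact ((hw i).mul_const _).aestronglyMeasurable
    · refine Filter.Eventually.of_forall fun ω => ?_
      rw [hz i]
      rcases hw01 i ω with h | h <;> simp [h]
  have hμ' : μhat = fun ω => (N : ℝ)⁻¹ * ∑ i, z i ω := by
    rw [hμhat]
    simp only [hz]
  have hL : MemLp μhat 2 μ := by
    rw [hμ']
    exact (memLp_finsetSum _ fun i _ => hzL i).const_mul _
  have hN' : (0 : ℝ) < N := by exact_mod_cast hN
  have hsum : ∑ j, covariance μhat (z j) μ = N * variance μhat μ := by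
    rw [← covariance_fun_sum_right hzL hL, ← covariance_self hL.aestronglyMeasurable.aemeasurable]
    conv_rhs => rw [hμ', covariance_const_mul_right, ← hμ']
    field_simp
  have hstep := fun j => aux_step μ (hw j).comap_le hL (hzL j) (by
    rw [hz j]
    exact ((comap_measurable (w j)).mul_const _).stronglyMeasurable)
  have hcs := sq_sum_le_card_mul_sum_sq (s := Finset.univ) (f := fun j => covariance μhat (z j) μ)
  rw [hsum] at hcs
  have hle := Finset.sum_le_sum (s := Finset.univ) fun j _ => hstep j
  simp only [Finset.card_univ, Fintype.card_fin] at hcs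
  simp only [mul_sub, Finset.sum_sub_distrib, ← Finset.sum_mul] at hle
  simp only [div_mul_eq_mul_div, ← Finset.sum_div]
  set V := variance μhat μ
  set D := ∑ i, variance (z i) μ
  have h5 : N * V ^ 2 ≤ ∑ j, (covariance μhat (z j) μ) ^ 2 := by
    refine le_of_mul_le_mul_left ?_ hN'
    linarith
  have h6 := h5.trans hle
  have h7 : V ^ 2 / ((N : ℝ)⁻¹ * D) = N * V ^ 2 / D := by
    field_simp
  rw [h7, div_le_iff₀ hden, sub_mul, div_mul_cancel₀ _ hden.ne']
  linarith
end

section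
/- For f(x) = √e·exp(−x²/(2η²)) and every nonnegative integer m, max_{x∈ℝ} |f^{(2m)}(x)| = |f^{(2m)}(0)| = √e · (2m)!/(m!) · (1/(2η²))^m, and max_{x∈ℝ}|f^{(2m+1)}(x)| ≤ |f^{(2m+2)}(0)|·η·const. In particular, max_x |f^{(2n+1)}(x)| ≤ √e·(2n+2)!/((n+1)!)·(1/(2η²))^{n+1}. -/
theorem aux_energy (c b : ℝ) (hc : 0 ≤ c) (u v w : ℝ → ℝ)
    (hu : ∀ x, HasDerivAt u (v x) x) (hv : ∀ x, HasDerivAt v (w x) x)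
    (hw : ∀ x, w x = -(c * x * v x) - b * u x) (x : ℝ) :
    b * u x ^ 2 + v x ^ 2 ≤ b * u 0 ^ 2 + v 0 ^ 2 := by
  have hE : ∀ x, HasDerivAt (fun y => b * u y ^ 2 + v y ^ 2) (-(2 * c * x * v x ^ 2)) x := by
    intro x
    have h := (((hu x).pow 2).const_mul b).add ((hv x).pow 2)
    refine HasDerivAt.congr_deriv h ?_
    rw [hw]
    push_cast
    ring
  have hcont : Continuous (fun y => b * u y ^ 2 + v y ^ 2) :=
    continuous_iff_continuousAt.2 fun x => (hE x).continuousAt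
  rcases le_total 0 x with hx | hx
  · have := antitoneOn_of_deriv_nonpos (convex_Ici (0 : ℝ)) hcont.continuousOn
      (fun y _ => (hE y).differentiableAt.differentiableWithinAt) (by
        intro y hy
        rw [interior_Ici] at hy
        rw [(hE y).deriv]
        have : 0 < y := hy
        have : 0 ≤ 2 * c * y * v y ^ 2 := by positivity
        linarith)
    exact this (Set.mem_Ici.2 le_rfl) (Set.mem_Ici.2 hx) hx
  · have := monotoneOn_of_deriv_nonneg (convex_Iic (0 : ℝ)) hcont.continuousOn
      (fun y _ => (hE y).differentiableAt.differentiableWithinAt) (by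
        intro y hy
        rw [interior_Iic] at hy
        rw [(hE y).deriv]
        have : 0 < -y := neg_pos.2 hy
        have : 0 ≤ 2 * c * (-y) * v y ^ 2 := by positivity
        linarith)
    exact this (Set.mem_Iic.2 hx) (Set.mem_Iic.2 le_rfl) hx

/-- Derivative bounds for the scaled Gaussian `f(x) = √e·exp(−x²/(2η²))`:
the even derivatives are maximized in absolute value at `0` with
`|f^{(2m)}(0)| = √e·(2m)!/m!·(1/(2η²))^m`, and the odd derivatives satisfy
`max_x |f^{(2n+1)}(x)| ≤ √e·(2n+2)!/(n+1)!·(1/(2η²))^{n+1}`. -/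
theorem stmt13 (η : ℝ) (hη0 : 0 < η) (hη1 : η ≤ 1 / 2) (f : ℝ → ℝ)
    (hf : f = fun x => Real.sqrt (Real.exp 1) * Real.exp (-x ^ 2 / (2 * η ^ 2))) :
    (∀ m : ℕ,
      (∀ x : ℝ, |iteratedDeriv (2 * m) f x| ≤ |iteratedDeriv (2 * m) f 0|) ∧
      |iteratedDeriv (2 * m) f 0| =
        Real.sqrt (Real.exp 1) * (Nat.factorial (2 * m) : ℝ) / (Nat.factorial m : ℝ) *
          (1 / (2 * η ^ 2)) ^ m) ∧
    ∀ n : ℕ, ∀ x : ℝ,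
      |iteratedDeriv (2 * n + 1) f x| ≤
        Real.sqrt (Real.exp 1) * (Nat.factorial (2 * n + 2) : ℝ) /
          (Nat.factorial (n + 1) : ℝ) * (1 / (2 * η ^ 2)) ^ (n + 1) := by
  obtain ⟨a, ha⟩ : ∃ a : ℝ, a = 1 / η ^ 2 := ⟨_, rfl⟩
  have ha1 : 1 ≤ a := by
    rw [ha, le_div_iff₀ (by positivity)]
    nlinarith
  have hsm : ContDiff ℝ ⊤ f := by
    rw [hf]
    fun_prop
  have hD : ∀ (n : ℕ) (x : ℝ),
      HasDerivAt (iteratedDeriv n f) (iteratedDeriv (n + 1) f x) x := by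
    intro n x
    rw [iteratedDeriv_succ]
    exact ((hsm.differentiable_iteratedDeriv n (by exact_mod_cast WithTop.coe_lt_top _)) x).hasDerivAt
  have h1 : ∀ x, iteratedDeriv 1 f x = -(a * x * f x) := by
    intro x
    rw [iteratedDeriv_one]
    have h := (((((hasDerivAt_id x).pow 2).neg).div_const (2 * η ^ 2)).exp).const_mul
      (Real.sqrt (Real.exp 1))
    have h2 : HasDerivAt f (-(a * x * f x)) x := by
      rw [hf]
      refine HasDerivAt.congr_deriv h ?_
      simp [ha]
      field_simp
    exact h2.deriv
  have hrec : ∀ (n : ℕ) (x : ℝ), iteratedDeriv (n + 2) f x =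
      -(a * x * iteratedDeriv (n + 1) f x) - ((n + 1) * a) * iteratedDeriv n f x := by
    intro n
    induction n with
    | zero =>
      intro x
      have e : iteratedDeriv 1 f = fun x => -(a * x * iteratedDeriv 0 f x) := by
        funext y; rw [h1, iteratedDeriv_zero]
      have h := (((hasDerivAt_id x).const_mul a).mul (hD 0 x)).neg
      have h' := hD 1 x
      rw [e] at h'
      have := h'.unique h
      simp only [zero_add] at this ⊢
      rw [show (2:ℕ) = 1 + 1 from rfl, this]
      simp
      ring
    | succ k ih =>
      intro x
      have e : iteratedDeriv (k + 2) f = fun x => -(a * x * iteratedDeriv (k + 1) f x) -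
          ((k + 1) * a) * iteratedDeriv k f x := funext ih
      have h := ((((hasDerivAt_id x).const_mul a).mul (hD (k + 1) x)).neg).sub
        ((hD k x).const_mul ((k + 1) * a))
      have h' := hD (k + 2) x
      rw [e] at h'
      have := h'.unique h
      rw [show k + 1 + 2 = k + 2 + 1 from rfl, this]
      simp
      ring
  have hodd : ∀ m : ℕ, iteratedDeriv (2 * m + 1) f 0 = 0 := by
    intro m
    induction m with
    | zero => simpa using h1 0
    | succ k ih =>
      have := hrec (2 * k + 1) 0
      rw [ih] at this
      rw [show 2 * (k + 1) + 1 = 2 * k + 1 + 2 by ring, this]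
      simp
  have hval : ∀ m : ℕ, |iteratedDeriv (2 * m) f 0| =
        Real.sqrt (Real.exp 1) * (Nat.factorial (2 * m) : ℝ) / (Nat.factorial m : ℝ) *
          (1 / (2 * η ^ 2)) ^ m := by
    intro m
    induction m with
    | zero => simp [hf, abs_of_nonneg (Real.sqrt_nonneg _)]
    | succ k ih =>
      have := hrec (2 * k) 0
      rw [show 2 * (k + 1) = 2 * k + 2 by ring, this, mul_zero, zero_mul, neg_zero, zero_sub,
        abs_neg, abs_mul, ih, abs_of_nonneg (by positivity), Nat.factorial_succ (2 * k + 1),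
        Nat.factorial_succ (2 * k), Nat.factorial_succ k, ha, pow_succ _ k]
      push_cast
      generalize (1 / (2 * η ^ 2) : ℝ) ^ k = q
      field_simp
      ring
  have hen : ∀ (m : ℕ) (x : ℝ), ((2 * m + 1) * a) * iteratedDeriv (2 * m) f x ^ 2 +
      iteratedDeriv (2 * m + 1) f x ^ 2 ≤ ((2 * m + 1) * a) * iteratedDeriv (2 * m) f 0 ^ 2 := by
    intro m x
    have := aux_energy a ((2 * m + 1) * a) (by linarith) _ _ _ (hD (2 * m)) (hD (2 * m + 1))
      (by intro x; have := hrec (2 * m) x; push_cast at this; exact this) x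
    rw [hodd] at this
    simpa using this
  refine ⟨fun m => ⟨fun x => ?_, hval m⟩, fun n x => ?_⟩
  · rw [← sq_le_sq]
    have h := hen m x
    have hp : 0 < (2 * (m : ℝ) + 1) * a := by positivity
    refine le_of_mul_le_mul_left ?_ hp
    nlinarith [sq_nonneg (iteratedDeriv (2 * m + 1) f x)]
  · have e := hval (n + 1)
    rw [show 2 * (n + 1) = 2 * n + 2 by ring] at e
    rw [← e, ← sq_le_sq, hrec (2 * n) 0]
    have h := hen n x
    have hp : 1 ≤ (2 * (n : ℝ) + 1) * a := by
      have : (0 : ℝ) ≤ n := n.cast_nonneg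
      nlinarith
    have hp0 : 0 ≤ (2 * (n : ℝ) + 1) * a := by linarith
    push_cast
    generalize (2 * (n : ℝ) + 1) * a = b at *
    have h3 : b * iteratedDeriv (2 * n) f 0 ^ 2 ≤ b * (b * iteratedDeriv (2 * n) f 0 ^ 2) :=
      le_mul_of_one_le_left (by positivity) hp
    nlinarith [mul_nonneg hp0 (sq_nonneg (iteratedDeriv (2 * n) f x))]
end
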